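/- There is no seven-term arithmetic progression with positive common difference all of whose terms lie in S; that is, there do not exist positive integers a and d such that a + i·d ∈ S for every i ∈ {0, 1, 2, 3, 4, 5, 6}. Consequently, the length of an arithmetic progression of the form 3^x + 2^y is at most six. -/

import Mathlib

/-- Properties of the summands `p i`, a power of `3`, and `q i`, a power of `2`, of the terms of a
seven-term arithmetic progression `a + i * d` that imply a contradiction. -/
structure Sys (a d : ℕ) (p q : ℕ → ℕ) : Prop where
  ha : 2 ≤ a
  hd : 24 ≤ d
  term : ∀ i ≤ 6, a + i * d = p i + q i
  p_pos : ∀ i ≤ 6, p i = 1 ∨ 3 ≤ p i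
  q_pos : ∀ i ≤ 6, (1 ≤ q i ∧ q i ≤ 4) ∨ 8 ≤ q i
  p_ratio : ∀ i ≤ 6, ∀ j ≤ 6, p i = p j ∨ 3 * p i = p j ∨ 9 * p i = p j ∨ 27 * p i ≤ p j ∨
    3 * p j = p i ∨ 9 * p j = p i ∨ 27 * p j ≤ p i
  q_ratio : ∀ i ≤ 6, ∀ j ≤ 6, q i = q j ∨ 2 * q i = q j ∨ 4 * q i = q j ∨ 8 * q i ≤ q j ∨
    2 * q j = q i ∨ 4 * q j = q i ∨ 8 * q j ≤ q i
  p_ratio_of_eight_le : ∀ i ≤ 6, ∀ j ≤ 6, 8 ≤ q i → 8 ≤ q j →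
    p i = p j ∨ 9 * p i = p j ∨ 81 * p i ≤ p j ∨ 9 * p j = p i ∨ 81 * p j ≤ p i
  q_ratio_of_three_le : ∀ i ≤ 6, ∀ j ≤ 6, 3 ≤ p i → 3 ≤ p j →
    q i = q j ∨ 4 * q i = q j ∨ 16 * q i ≤ q j ∨ 4 * q j = q i ∨ 16 * q j ≤ q i
  p_eq : ∀ i j, i < j → j ≤ 6 → p i = p j → 8 ≤ q i ∧ 4 * q i ≤ q j
  q_eq : ∀ i j, i < j → j ≤ 6 → q i = q j → 3 ≤ p i ∧ 9 * p i ≤ p j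

theorem three_pow_mod_eight (x : ℕ) : 3 ^ x % 8 = if x % 2 = 0 then 1 else 3 := by
  induction x with
  | zero => rfl
  | succ n ih => rw [pow_succ]; split_ifs at ih ⊢ <;> omega

theorem two_pow_mod_three (y : ℕ) : 2 ^ y % 3 = if y % 2 = 0 then 1 else 2 := by
  induction y with
  | zero => rfl
  | succ n ih => rw [pow_succ]; split_ifs at ih ⊢ <;> omega

theorem three_pow_eq_one_or (x : ℕ) : 3 ^ x = 1 ∨ 3 ≤ 3 ^ x ∧ 3 ^ x % 3 = 0 := by
  rcases x with _ | x
  · simp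
  · right
    have := Nat.pow_pos (n := x) (show 0 < 3 by decide)
    rw [pow_succ]
    omega

theorem two_pow_le_four_or (y : ℕ) :
    y = 0 ∧ 2 ^ y = 1 ∨ y = 1 ∧ 2 ^ y = 2 ∨ y = 2 ∧ 2 ^ y = 4 ∨ 8 ≤ 2 ^ y ∧ 2 ^ y % 8 = 0 := by
  rcases y with _ | _ | _ | y
  · simp
  · simp
  · simp
  · have := Nat.pow_pos (n := y) (show 0 < 2 by decide)
    have : 2 ^ (y + 1 + 1 + 1) = 2 ^ y * 8 := by ring
    omega

theorem pow_ratio_of_le (b : ℕ) {m n : ℕ} (hb : 0 < b) (h : m ≤ n) :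
    b ^ m = b ^ n ∨ b * b ^ m = b ^ n ∨ b ^ 2 * b ^ m = b ^ n ∨ b ^ 3 * b ^ m ≤ b ^ n := by
  obtain ⟨k, rfl⟩ := Nat.exists_eq_add_of_le h
  rcases k with _ | _ | _ | k
  · simp
  · right; left; ring
  · right; right; left; ring
  · right; right; right
    rw [← pow_add]
    exact Nat.pow_le_pow_right hb (by omega)

theorem pow_ratio_of_le_of_mod_two_eq (b : ℕ) {m n : ℕ} (hb : 0 < b) (h : m ≤ n)
    (hmn : m % 2 = n % 2) :
    b ^ m = b ^ n ∨ b ^ 2 * b ^ m = b ^ n ∨ b ^ 4 * b ^ m ≤ b ^ n := by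
  obtain ⟨k, rfl⟩ := Nat.exists_eq_add_of_le h
  rcases k with _ | _ | _ | _ | k
  · simp
  · omega
  · right; left; ring
  · omega
  · right; right
    rw [← pow_add]
    exact Nat.pow_le_pow_right hb (by omega)

set_option synthInstance.maxHeartbeats 400000 in
set_option synthInstance.maxSize 1000 in
set_option maxRecDepth 10000 in
theorem exists_residue_pair : ∀ r < 8, ∀ s < 8, s ≠ 0 →
    ∃ i ∈ Finset.Icc 2 5, ∃ j ∈ Finset.Icc (i + 1) (i + 2), j ≤ 6 ∧
      ((r + i * s) % 8 % 2 = 0 ∧ (r + j * s) % 8 % 2 = 0 ∨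
        ((r + i * s) % 8 = 5 ∨ (r + i * s) % 8 = 7) ∧
        ((r + j * s) % 8 = 5 ∨ (r + j * s) % 8 = 7)) := by
  decide

section Divisibility

variable {a d : ℕ} {x y : ℕ → ℕ}

theorem two_le_of_ap (h : ∀ i ≤ 6, a + i * d = 3 ^ x i + 2 ^ y i) : 2 ≤ a := by
  have := h 0 (by omega)
  have := Nat.pow_pos (n := x 0) (show 0 < 3 by decide)
  have := Nat.pow_pos (n := y 0) (show 0 < 2 by decide)
  omega

theorem three_dvd_of_ap (hd : 0 < d) (h : ∀ i ≤ 6, a + i * d = 3 ^ x i + 2 ^ y i) : 3 ∣ d := by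
  by_contra hd3
  have ha := two_le_of_ap h
  have key : ∀ i ≤ 6, (a + i * d) % 3 = 0 → a + i * d = 1 + 2 ^ y i := by
    intro i hi hm
    have h1 := h i hi
    have h2 := three_pow_eq_one_or (x i)
    have h3 := two_pow_mod_three (y i)
    split_ifs at h3 <;> omega
  have pair : ∀ i, 0 < i → i ≤ 2 → (a + i * d) % 3 ≠ 0 := by
    intro i hi0 hi2 hm
    have h1 := key i (by omega) hm
    have h2 := key (i + 3) (by omega) (by rw [add_mul]; omega)
    rw [add_mul] at h2
    have hlt : 2 ^ y i < 2 ^ y (i + 3) := by omega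
    have hdvd : 2 ^ y i ∣ 2 ^ y (i + 3) :=
      pow_dvd_pow 2 ((Nat.pow_lt_pow_iff_right (by decide)).1 hlt).le
    have h3d : 2 ^ y i ∣ 3 * d := by
      have : 3 * d = 2 ^ y (i + 3) - 2 ^ y i := by omega
      rw [this]
      exact Nat.dvd_sub hdvd dvd_rfl
    have hle := Nat.le_of_dvd hd
      ((Nat.Coprime.pow_left (y i) (by decide : Nat.Coprime 2 3)).dvd_of_dvd_mul_left h3d)
    have := Nat.mul_le_mul_right d hi0
    omega
  have h1 := pair 1 (by omega) (by omega)
  have h2 := pair 2 (by omega) (by omega)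
  have ha3 : a % 3 = 0 := by
    have : a % 3 = 0 ∨ a % 3 = 1 ∨ a % 3 = 2 := by omega
    have : d % 3 = 1 ∨ d % 3 = 2 := by omega
    omega
  have h0 := key 0 (by omega) (by omega)
  have h3 := key 3 (by omega) (by omega)
  have h6 := key 6 (by omega) (by omega)
  have hlt : 2 ^ y 3 < 2 ^ y 6 := by omega
  have hle : 2 ^ (y 3 + 1) ≤ 2 ^ y 6 :=
    Nat.pow_le_pow_right (by decide) ((Nat.pow_lt_pow_iff_right (by decide)).1 hlt)
  rw [pow_succ] at hle
  have := Nat.pow_pos (n := y 0) (show 0 < 2 by decide)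
  omega

theorem eight_dvd_of_ap (hd : 0 < d) (h : ∀ i ≤ 6, a + i * d = 3 ^ x i + 2 ^ y i) : 8 ∣ d := by
  have ha := two_le_of_ap h
  have hd3 := three_dvd_of_ap hd h
  have key : ∀ i j, 2 ≤ i → i < j → j ≤ i + 2 → j ≤ 6 → 2 ^ y i = 2 ^ y j → 4 < 2 ^ y i := by
    intro i j hi hij hj2 hj h2
    by_contra! h4
    have h1 := h i (by omega)
    have h3 := h j hj
    have e1 := Nat.mul_le_mul_right d hi
    have e2 := Nat.mul_le_mul_right d hij
    have e3 := Nat.mul_le_mul_right d hj2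
    rw [Nat.succ_mul] at e2
    rw [Nat.add_mul] at e3
    have hlt : 3 ^ x i < 3 ^ x j := by omega
    have hle : 3 ^ (x i + 1) ≤ 3 ^ x j :=
      Nat.pow_le_pow_right (by decide) ((Nat.pow_lt_pow_iff_right (by decide)).1 hlt)
    rw [pow_succ] at hle
    omega
  have even : ∀ i, i ≤ 6 → (a + i * d) % 2 = 0 → 2 ^ y i = 1 := by
    intro i hi hm
    have := h i hi
    have := two_pow_le_four_or (y i)
    have := three_pow_mod_eight (x i)
    split_ifs at this <;> omega
  have odd : ∀ i, 2 ≤ i → i ≤ 6 → (a + i * d) % 8 = 5 ∨ (a + i * d) % 8 = 7 →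
      2 ^ y i = 2 ∧ a % 3 = 2 ∨ 2 ^ y i = 4 ∧ a % 3 = 1 := by
    intro i hi2 hi hm
    have h1 := h i hi
    have h2 := two_pow_le_four_or (y i)
    have h3 := three_pow_mod_eight (x i)
    have h4 := three_pow_eq_one_or (x i)
    have h5 := Nat.mul_le_mul_right d hi2
    have h6 : 3 ∣ i * d := hd3.mul_left i
    split_ifs at h3 <;> omega
  have even_pair : ∀ i j, 2 ≤ i → i < j → j ≤ i + 2 → j ≤ 6 →
      ¬ ((a + i * d) % 2 = 0 ∧ (a + j * d) % 2 = 0) := by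
    rintro i j hi hij hj2 hj ⟨h1, h2⟩
    have := even i (by omega) h1
    have := even j hj h2
    have := key i j hi hij hj2 hj (by omega)
    omega
  have odd_pair : ∀ i j, 2 ≤ i → i < j → j ≤ i + 2 → j ≤ 6 →
      ¬ (((a + i * d) % 8 = 5 ∨ (a + i * d) % 8 = 7) ∧
        ((a + j * d) % 8 = 5 ∨ (a + j * d) % 8 = 7)) := by
    rintro i j hi hij hj2 hj ⟨h1, h2⟩
    have := odd i hi (by omega) h1
    have := odd j (by omega) hj h2
    have := key i j hi hij hj2 hj (by omega)
    omega
  by_contra hd8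
  obtain ⟨i, hi, j, hj, hj6, hr⟩ := exists_residue_pair (a % 8)
    (Nat.mod_lt _ (by decide)) (d % 8) (Nat.mod_lt _ (by decide)) (by omega)
  rw [Finset.mem_Icc] at hi hj
  have red : ∀ i, (a % 8 + i * (d % 8)) % 8 = (a + i * d) % 8 := by
    intro i
    simp [Nat.add_mod, Nat.mul_mod]
  rw [red, red] at hr
  rcases hr with ⟨h1, h2⟩ | hr
  · exact even_pair i j hi.1 hj.1 hj.2 hj6 ⟨by omega, by omega⟩
  · exact odd_pair i j hi.1 hj.1 hj.2 hj6 hr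

end Divisibility

theorem Sys.of_ap {a d : ℕ} {x y : ℕ → ℕ} (hd : 0 < d)
    (h : ∀ i ≤ 6, a + i * d = 3 ^ x i + 2 ^ y i) :
    Sys a d (fun i ↦ 3 ^ x i) (fun i ↦ 2 ^ y i) := by
  have hd3 := three_dvd_of_ap hd h
  have hd8 := eight_dvd_of_ap hd h
  have hd24 : 24 ∣ d := by omega
  have x_mod : ∀ i ≤ 6, ∀ j ≤ 6, 2 ^ y i % 8 = 2 ^ y j % 8 → x i % 2 = x j % 2 := by
    intro i hi j hj hij
    have := h i hi
    have := h j hj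
    have := hd24.mul_left i
    have := hd24.mul_left j
    have h1 := three_pow_mod_eight (x i)
    have h2 := three_pow_mod_eight (x j)
    split_ifs at h1 h2 <;> omega
  have y_mod : ∀ i ≤ 6, ∀ j ≤ 6, 3 ^ x i % 3 = 3 ^ x j % 3 → y i % 2 = y j % 2 := by
    intro i hi j hj hij
    have := h i hi
    have := h j hj
    have := hd24.mul_left i
    have := hd24.mul_left j
    have h1 := two_pow_mod_three (y i)
    have h2 := two_pow_mod_three (y j)
    split_ifs at h1 h2 <;> omega
  refine ⟨two_le_of_ap h, Nat.le_of_dvd hd hd24, h, fun i _ ↦ ?_, fun i _ ↦ ?_,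
    fun i _ j _ ↦ ?_, fun i _ j _ ↦ ?_, fun i hi j hj hqi hqj ↦ ?_, fun i hi j hj hpi hpj ↦ ?_,
    fun i j hij hj hp ↦ ?_, fun i j hij hj hq ↦ ?_⟩ <;> beta_reduce at *
  · have := three_pow_eq_one_or (x i)
    omega
  · have := two_pow_le_four_or (y i)
    omega
  · rcases le_total (x i) (x j) with hle | hle <;>
      have := pow_ratio_of_le 3 (by decide) hle <;> omega
  · rcases le_total (y i) (y j) with hle | hle <;>
      have := pow_ratio_of_le 2 (by decide) hle <;> omega
  · have := two_pow_le_four_or (y i)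
    have := two_pow_le_four_or (y j)
    have hm := x_mod i hi j hj (by omega)
    rcases le_total (x i) (x j) with hle | hle
    · have := pow_ratio_of_le_of_mod_two_eq 3 (by decide) hle hm
      omega
    · have := pow_ratio_of_le_of_mod_two_eq 3 (by decide) hle hm.symm
      omega
  · have := three_pow_eq_one_or (x i)
    have := three_pow_eq_one_or (x j)
    have hm := y_mod i hi j hj (by omega)
    rcases le_total (y i) (y j) with hle | hle
    · have := pow_ratio_of_le_of_mod_two_eq 2 (by decide) hle hm
      omega
    · have := pow_ratio_of_le_of_mod_two_eq 2 (by decide) hle hm.symm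
      omega
  · have hi := h i (by omega)
    have hj' := h j hj
    have h1 := hd24.mul_left i
    have h2 := hd24.mul_left j
    have h3 := Nat.mul_lt_mul_of_pos_right hij hd
    have hlt : 2 ^ y i < 2 ^ y j := by omega
    have := two_pow_le_four_or (y i)
    have := two_pow_le_four_or (y j)
    have := pow_ratio_of_le_of_mod_two_eq 2 (by decide)
      ((Nat.pow_lt_pow_iff_right (by decide)).1 hlt).le (y_mod i (by omega) j hj (by omega))
    omega
  · have hi := h i (by omega)
    have hj' := h j hj
    have h1 := hd24.mul_left i
    have h2 := hd24.mul_left j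
    have h3 := Nat.mul_lt_mul_of_pos_right hij hd
    have hlt : 3 ^ x i < 3 ^ x j := by omega
    have := three_pow_eq_one_or (x i)
    have := three_pow_eq_one_or (x j)
    have := pow_ratio_of_le_of_mod_two_eq 3 (by decide)
      ((Nat.pow_lt_pow_iff_right (by decide)).1 hlt).le (x_mod i (by omega) j hj (by omega))
    omega

/-- The kinds of representations `p + q` of a large number, with `p` a power of `3` and `q` a power
of `2`: either `p = 1`, or `q` is small, or `q` dominates, or `p` dominates. -/
inductive Kind
  | one | small | two | three

/-- The representation `p + q` is of the given kind. -/
def Kind.Holds : Kind → ℕ → ℕ → Prop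
  | .one, p, _ => p = 1
  | .small, _, q => q ≤ 4
  | .two, p, q => 3 ≤ p ∧ 8 ≤ q ∧ p ≤ q
  | .three, p, q => 3 ≤ p ∧ 8 ≤ q ∧ q ≤ p

/-- Relation between the representations `p + q` and `p' + q'`, of given kinds, of two terms of the
progression, the first one preceding the second one. -/
def Kind.Rel : Kind → Kind → ℕ → ℕ → ℕ → ℕ → Prop
  | .one, .one, _, _, _, _ => False
  | .one, .two, _, q, _, q' => q = 2 * q' ∨ 2 * q = q'
  | .two, .one, _, q', _, q => q = 2 * q' ∨ 2 * q = q'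
  | .one, .three, _, q, _, q' => q = 2 * q' ∨ q = 4 * q' ∨ 8 * q' ≤ q
  | .three, .one, _, q', _, q => q = 2 * q' ∨ q = 4 * q' ∨ 8 * q' ≤ q
  | .small, .small, _, _, _, _ => False
  | .small, .two, p, _, p', _ => p = 3 * p' ∨ p = 9 * p' ∨ 27 * p' ≤ p
  | .two, .small, p', _, p, _ => p = 3 * p' ∨ p = 9 * p' ∨ 27 * p' ≤ p
  | .small, .three, p, _, p', _ => p = 3 * p' ∨ 3 * p = p'
  | .three, .small, p', _, p, _ => p = 3 * p' ∨ 3 * p = p'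
  | .two, .two, p, q, p', q' => q = q' ∧ 9 * p ≤ p'
  | .three, .three, p, q, p', q' => p = p' ∧ 4 * q ≤ q'
  | .two, .three, p, q, p', q' =>
    (p = p' ∨ 9 * p = p' ∨ 81 * p ≤ p') ∧ (q' = q ∨ 4 * q' = q ∨ 16 * q' ≤ q)
  | .three, .two, p', q', p, q =>
    (p = p' ∨ 9 * p = p' ∨ 81 * p ≤ p') ∧ (q' = q ∨ 4 * q' = q ∨ 16 * q' ≤ q)
  | .one, .small, _, _, _, _ => True
  | .small, .one, _, _, _, _ => True

namespace Sys

variable {a d : ℕ} {p q : ℕ → ℕ}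

theorem q_dominant_pair (h : Sys a d p q) (hl : 6 * d + 2 ≤ a) (i j : ℕ)
    (hi : 2 ≤ i) (hij : i < j) (hj : j ≤ 6) (h1 : p i ≤ q i) (h2 : p j ≤ q j) :
    (q i = q j ∧ 9 * p i ≤ p j) ∨
      ((p i = 1 ∨ p j = 1) ∧ ¬ (p i = 1 ∧ p j = 1) ∧ (2 * q i = q j ∨ 2 * q j = q i)) := by
  have := h.term i (by omega)
  have := h.term j (by omega)
  have := h.q_ratio i (by omega) j hj
  have := h.q_ratio_of_three_le i (by omega) j hj
  have := h.q_eq i j hij hj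
  have := h.p_pos i (by omega)
  have := h.p_pos j (by omega)
  have := h.ha
  have := h.hd
  have e1 := Nat.mul_le_mul_right d hi
  have e2 := Nat.mul_le_mul_right d hij
  have e3 := Nat.mul_le_mul_right d hj
  rw [Nat.succ_mul] at e2
  generalize i * d = u at *
  generalize j * d = v at *
  omega

theorem p_dominant_pair (h : Sys a d p q) (hl : 6 * d + 2 ≤ a) (i j : ℕ)
    (hi : 2 ≤ i) (hij : i < j) (hj : j ≤ 6) (h1 : q i ≤ p i) (h2 : q j ≤ p j) :
    (p i = p j ∧ 4 * q i ≤ q j) ∨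
      ((q i ≤ 4 ∨ q j ≤ 4) ∧ ¬ (q i ≤ 4 ∧ q j ≤ 4) ∧ (3 * p i = p j ∨ 3 * p j = p i)) := by
  have := h.term i (by omega)
  have := h.term j (by omega)
  have := h.p_ratio i (by omega) j hj
  have := h.p_ratio_of_eight_le i (by omega) j hj
  have := h.p_eq i j hij hj
  have := h.q_pos i (by omega)
  have := h.q_pos j (by omega)
  have := h.ha
  have := h.hd
  have e1 := Nat.mul_le_mul_right d hi
  have e2 := Nat.mul_le_mul_right d hij
  have e3 := Nat.mul_le_mul_right d hj
  rw [Nat.succ_mul] at e2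
  generalize i * d = u at *
  generalize j * d = v at *
  omega

theorem q_dominant_triple (h : Sys a d p q) (hl : 6 * d + 2 ≤ a) (i j k : ℕ)
    (hi : 2 ≤ i) (hij : i < j) (hjk : j < k) (hk : k ≤ 6)
    (h1 : p i ≤ q i) (h2 : p j ≤ q j) (h3 : p k ≤ q k) : False := by
  have := h.term i (by omega)
  have := h.term j (by omega)
  have := h.term k (by omega)
  have := h.q_dominant_pair hl i j hi hij (by omega) h1 h2
  have := h.q_dominant_pair hl i k hi (by omega) (by omega) h1 h3
  have := h.q_dominant_pair hl j k (by omega) hjk (by omega) h2 h3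
  have := h.ha
  have := h.hd
  have hi6 : i ≤ 4 := by omega
  have hj5 : j ≤ 5 := by omega
  interval_cases i <;> interval_cases j <;> interval_cases k <;> omega

theorem p_dominant_triple (h : Sys a d p q) (hl : 6 * d + 2 ≤ a) (i j k : ℕ)
    (hi : 2 ≤ i) (hij : i < j) (hjk : j < k) (hk : k ≤ 6)
    (h1 : q i ≤ p i) (h2 : q j ≤ p j) (h3 : q k ≤ p k) : False := by
  have := h.term i (by omega)
  have := h.term j (by omega)
  have := h.term k (by omega)
  have := h.p_dominant_pair hl i j hi hij (by omega) h1 h2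
  have := h.p_dominant_pair hl i k hi (by omega) (by omega) h1 h3
  have := h.p_dominant_pair hl j k (by omega) hjk (by omega) h2 h3
  have := h.q_pos i (by omega)
  have := h.q_pos j (by omega)
  have := h.q_pos k (by omega)
  have := h.ha
  have := h.hd
  have hi6 : i ≤ 4 := by omega
  have hj5 : j ≤ 5 := by omega
  interval_cases i <;> interval_cases j <;> interval_cases k <;> omega

theorem a_le (h : Sys a d p q) : a ≤ 6 * d + 1 := by
  by_contra! hl
  have P := h.p_dominant_triple hl
  have Q := h.q_dominant_triple hl
  rcases le_total (p 2) (q 2) with h2 | h2 <;> rcases le_total (p 3) (q 3) with h3 | h3 <;>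
  rcases le_total (p 4) (q 4) with h4 | h4 <;> rcases le_total (p 5) (q 5) with h5 | h5 <;>
  rcases le_total (p 6) (q 6) with h6 | h6 <;>
  first
  | exact P 2 3 4 (by omega) (by omega) (by omega) (by omega) h2 h3 h4
  | exact P 2 3 5 (by omega) (by omega) (by omega) (by omega) h2 h3 h5
  | exact P 2 3 6 (by omega) (by omega) (by omega) (by omega) h2 h3 h6
  | exact P 2 4 5 (by omega) (by omega) (by omega) (by omega) h2 h4 h5
  | exact P 2 4 6 (by omega) (by omega) (by omega) (by omega) h2 h4 h6
  | exact P 2 5 6 (by omega) (by omega) (by omega) (by omega) h2 h5 h6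
  | exact P 3 4 5 (by omega) (by omega) (by omega) (by omega) h3 h4 h5
  | exact P 3 4 6 (by omega) (by omega) (by omega) (by omega) h3 h4 h6
  | exact P 3 5 6 (by omega) (by omega) (by omega) (by omega) h3 h5 h6
  | exact P 4 5 6 (by omega) (by omega) (by omega) (by omega) h4 h5 h6
  | exact Q 2 3 4 (by omega) (by omega) (by omega) (by omega) h2 h3 h4
  | exact Q 2 3 5 (by omega) (by omega) (by omega) (by omega) h2 h3 h5
  | exact Q 2 3 6 (by omega) (by omega) (by omega) (by omega) h2 h3 h6
  | exact Q 2 4 5 (by omega) (by omega) (by omega) (by omega) h2 h4 h5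
  | exact Q 2 4 6 (by omega) (by omega) (by omega) (by omega) h2 h4 h6
  | exact Q 2 5 6 (by omega) (by omega) (by omega) (by omega) h2 h5 h6
  | exact Q 3 4 5 (by omega) (by omega) (by omega) (by omega) h3 h4 h5
  | exact Q 3 4 6 (by omega) (by omega) (by omega) (by omega) h3 h4 h6
  | exact Q 3 5 6 (by omega) (by omega) (by omega) (by omega) h3 h5 h6
  | exact Q 4 5 6 (by omega) (by omega) (by omega) (by omega) h4 h5 h6

theorem not_ones (h : Sys a d p q) (i j : ℕ) (hi : 3 ≤ i) (hij : i < j) (hj : j ≤ 6)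
    (h1 : p i = 1) (h2 : p j = 1) : False := by
  have := h.term i (by omega)
  have := h.term j (by omega)
  have := h.q_ratio i (by omega) j hj
  have := h.ha
  have := h.hd
  have hi6 : i ≤ 6 := by omega
  interval_cases i <;> interval_cases j <;> omega

theorem not_smalls (h : Sys a d p q) (i j : ℕ) (hi : 3 ≤ i) (hij : i < j) (hj : j ≤ 6)
    (h1 : q i ≤ 4) (h2 : q j ≤ 4) : False := by
  have := h.term i (by omega)
  have := h.term j (by omega)
  have := h.p_ratio i (by omega) j hj
  have := h.p_eq i j hij hj
  have := h.ha
  have := h.hd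
  have hi6 : i ≤ 6 := by omega
  interval_cases i <;> interval_cases j <;> omega

theorem two_two (h : Sys a d p q) (i j : ℕ) (hi : 3 ≤ i) (hij : i < j) (hj : j ≤ 6)
    (h1 : 3 ≤ p i ∧ 8 ≤ q i ∧ p i ≤ q i) (h2 : 3 ≤ p j ∧ 8 ≤ q j ∧ p j ≤ q j) :
    q i = q j ∧ 9 * p i ≤ p j := by
  have := h.term i (by omega)
  have := h.term j (by omega)
  have := h.q_ratio_of_three_le i (by omega) j hj h1.1 h2.1
  have := h.q_eq i j hij hj
  have := h.ha
  have := h.hd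
  have hi6 : i ≤ 6 := by omega
  interval_cases i <;> interval_cases j <;> omega

theorem three_three (h : Sys a d p q) (i j : ℕ) (hi : 3 ≤ i) (hij : i < j) (hj : j ≤ 6)
    (h1 : 3 ≤ p i ∧ 8 ≤ q i ∧ q i ≤ p i) (h2 : 3 ≤ p j ∧ 8 ≤ q j ∧ q j ≤ p j) :
    p i = p j ∧ 4 * q i ≤ q j := by
  have := h.term i (by omega)
  have := h.term j (by omega)
  have := h.p_ratio_of_eight_le i (by omega) j hj h1.2.1 h2.2.1
  have := h.p_eq i j hij hj
  have := h.ha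
  have := h.hd
  have hi6 : i ≤ 6 := by omega
  interval_cases i <;> interval_cases j <;> omega

theorem two_three (h : Sys a d p q) (i j : ℕ) (hi : 3 ≤ i) (hi' : i ≤ 6) (hj : 3 ≤ j)
    (hj' : j ≤ 6)
    (h1 : 3 ≤ p i ∧ 8 ≤ q i ∧ p i ≤ q i) (h2 : 3 ≤ p j ∧ 8 ≤ q j ∧ q j ≤ p j) :
    (p i = p j ∨ 9 * p i = p j ∨ 81 * p i ≤ p j) ∧
      (q j = q i ∨ 4 * q j = q i ∨ 16 * q j ≤ q i) := by
  have := h.term i (by omega)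
  have := h.term j (by omega)
  have := h.p_ratio_of_eight_le i (by omega) j hj' h1.2.1 h2.2.1
  have := h.q_ratio_of_three_le i (by omega) j hj' h1.1 h2.1
  have := h.ha
  have := h.hd
  interval_cases i <;> interval_cases j <;> omega

theorem one_two (h : Sys a d p q) (i j : ℕ) (hi : 3 ≤ i) (hi' : i ≤ 6) (hj : 3 ≤ j)
    (hj' : j ≤ 6)
    (h1 : p i = 1) (h2 : 3 ≤ p j ∧ 8 ≤ q j ∧ p j ≤ q j) :
    q i = 2 * q j ∨ 2 * q i = q j := by
  have := h.term i (by omega)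
  have := h.term j (by omega)
  have := h.q_ratio i (by omega) j hj'
  have := h.q_eq i j
  have := h.q_eq j i
  have := h.ha
  have := h.hd
  interval_cases i <;> interval_cases j <;> omega

theorem one_three (h : Sys a d p q) (i j : ℕ) (hi : 3 ≤ i) (hi' : i ≤ 6) (hj : 3 ≤ j)
    (hj' : j ≤ 6)
    (h1 : p i = 1) (h2 : 3 ≤ p j ∧ 8 ≤ q j ∧ q j ≤ p j) :
    q i = 2 * q j ∨ q i = 4 * q j ∨ 8 * q j ≤ q i := by
  have := h.term i (by omega)
  have := h.term j (by omega)
  have := h.q_ratio i (by omega) j hj'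
  have := h.q_eq i j
  have := h.q_eq j i
  have := h.ha
  have := h.hd
  interval_cases i <;> interval_cases j <;> omega

theorem small_three (h : Sys a d p q) (i j : ℕ) (hi : 3 ≤ i) (hi' : i ≤ 6) (hj : 3 ≤ j)
    (hj' : j ≤ 6)
    (h1 : q i ≤ 4) (h2 : 3 ≤ p j ∧ 8 ≤ q j ∧ q j ≤ p j) :
    p i = 3 * p j ∨ 3 * p i = p j := by
  have := h.term i (by omega)
  have := h.term j (by omega)
  have := h.p_ratio i (by omega) j hj'
  have := h.p_eq i j
  have := h.p_eq j i
  have := h.ha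
  have := h.hd
  interval_cases i <;> interval_cases j <;> omega

theorem small_two (h : Sys a d p q) (i j : ℕ) (hi : 3 ≤ i) (hi' : i ≤ 6) (hj : 3 ≤ j)
    (hj' : j ≤ 6)
    (h1 : q i ≤ 4) (h2 : 3 ≤ p j ∧ 8 ≤ q j ∧ p j ≤ q j) :
    p i = 3 * p j ∨ p i = 9 * p j ∨ 27 * p j ≤ p i := by
  have := h.term i (by omega)
  have := h.term j (by omega)
  have := h.p_ratio i (by omega) j hj'
  have := h.p_eq i j
  have := h.p_eq j i
  have := h.ha
  have := h.hd
  interval_cases i <;> interval_cases j <;> omega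

theorem exists_kind (h : Sys a d p q) (i : ℕ) (hi : i ≤ 6) : ∃ K : Kind, K.Holds (p i) (q i) := by
  have hp := h.p_pos i hi
  have hq := h.q_pos i hi
  have hk : p i = 1 ∨ q i ≤ 4 ∨ (3 ≤ p i ∧ 8 ≤ q i ∧ p i ≤ q i) ∨
      (3 ≤ p i ∧ 8 ≤ q i ∧ q i ≤ p i) := by
    omega
  rcases hk with k | k | k | k
  exacts [⟨.one, k⟩, ⟨.small, k⟩, ⟨.two, k⟩, ⟨.three, k⟩]

theorem rel (h : Sys a d p q) {i j : ℕ} (hi : 3 ≤ i) (hij : i < j) (hj : j ≤ 6) {K L : Kind}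
    (hK : K.Holds (p i) (q i)) (hL : L.Holds (p j) (q j)) : K.Rel L (p i) (q i) (p j) (q j) := by
  have hi' : i ≤ 6 := by omega
  have hj' : 3 ≤ j := by omega
  cases K <;> cases L
  · exact h.not_ones i j hi hij hj hK hL
  · trivial
  · exact h.one_two i j hi hi' hj' hj hK hL
  · exact h.one_three i j hi hi' hj' hj hK hL
  · trivial
  · exact h.not_smalls i j hi hij hj hK hL
  · exact h.small_two i j hi hi' hj' hj hK hL
  · exact h.small_three i j hi hi' hj' hj hK hL
  · exact h.one_two j i hj' hj hi hi' hL hK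
  · exact h.small_two j i hj' hj hi hi' hL hK
  · exact h.two_two i j hi hij hj hK hL
  · exact h.two_three i j hi hi' hj' hj hK hL
  · exact h.one_three j i hj' hj hi hi' hL hK
  · exact h.small_three j i hj' hj hi hi' hL hK
  · exact h.two_three j i hj' hj hi hi' hL hK
  · exact h.three_three i j hi hij hj hK hL

set_option maxHeartbeats 10000000 in
theorem elim (h : Sys a d p q) : False := by
  obtain ⟨K, hK⟩ := h.exists_kind 3 (by omega)
  obtain ⟨L, hL⟩ := h.exists_kind 4 (by omega)
  obtain ⟨M, hM⟩ := h.exists_kind 5 (by omega)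
  obtain ⟨N, hN⟩ := h.exists_kind 6 (by omega)
  have r34 := h.rel (by omega) (by omega) (by omega) hK hL
  have r35 := h.rel (by omega) (by omega) (by omega) hK hM
  have r36 := h.rel (by omega) (by omega) (by omega) hK hN
  have r45 := h.rel (by omega) (by omega) (by omega) hL hM
  have r46 := h.rel (by omega) (by omega) (by omega) hL hN
  have r56 := h.rel (by omega) (by omega) (by omega) hM hN
  have t3 := h.term 3 (by omega)
  have t4 := h.term 4 (by omega)
  have t5 := h.term 5 (by omega)
  have t6 := h.term 6 (by omega)
  have hl := h.a_le
  have ha := h.ha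
  have hd := h.hd
  clear h
  generalize p 3 = p3, p 4 = p4, p 5 = p5, p 6 = p6, q 3 = q3, q 4 = q4, q 5 = q5, q 6 = q6 at *
  cases K <;> cases L <;> simp only [Kind.Rel] at r34 <;>
  cases M <;> simp only [Kind.Rel] at r35 r45 <;>
  cases N <;> simp only [Kind.Rel] at r36 r46 r56 <;>
  simp only [Kind.Holds] at hK hL hM hN <;> omega

end Sys


/-- Let `S = {3^x + 2^y : x, y ∈ ℕ}`.  There is no seven-term arithmetic
progression with positive common difference all of whose terms lie in `S`. -/
theorem no_seven_term_ap_in_S :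
    ¬ ∃ a d : ℕ, 0 < a ∧ 0 < d ∧
      ∀ i : ℕ, i ≤ 6 → ∃ x y : ℕ, a + i * d = 3 ^ x + 2 ^ y := by
  rintro ⟨a, d, -, hd, h⟩
  choose! x y h using h
  exact (Sys.of_ap hd h).elim
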